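/- Let G = (V,E) be a finite simple graph and let β : E → ℝ satisfy β(e) ≥ 0 for all e ∈ E. Define λ(e) = tanh β(e) and p(e) = 1 − exp(−2β(e)) for each edge e. Then Z_rc(p) = Z_subs(λ) · 2^{|V| − |E|} · ∏_{e ∈ E} (1 + exp(−2β(e))). -/

import Mathlib

open Finset

variable {V : Type*} [Fintype V] [DecidableEq V]

/-- An edge subset is *even* if every vertex has even degree in it. -/
def IsEvenSubgraph (y : Finset (Sym2 V)) : Prop :=
  ∀ i : V, Even ((y.filter (fun e => i ∈ e)).card)

instance (y : Finset (Sym2 V)) : Decidable (IsEvenSubgraph y) :=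
  inferInstanceAs (Decidable (∀ i : V, Even ((y.filter (fun e => i ∈ e)).card)))

/-- Number of connected components of the graph `(V, z)` (isolated vertices count). -/
noncomputable def numComponents (z : Finset (Sym2 V)) : ℕ :=
  Nat.card (SimpleGraph.fromEdgeSet (z : Set (Sym2 V))).ConnectedComponent

/-- The product `x i * x j` of the two spins at the endpoints of an edge, as a real number. -/
def edgeSpinProd (x : V → ℤˣ) : Sym2 V → ℝ :=
  Sym2.lift ⟨fun i j => ((x i : ℤ) : ℝ) * ((x j : ℤ) : ℝ), fun i j => by ring⟩

/-- Spins partition function. -/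
noncomputable def Zspins (G : SimpleGraph V) [DecidableRel G.Adj] (β : Sym2 V → ℝ) : ℝ :=
  ∑ x : V → ℤˣ, ∏ e ∈ G.edgeFinset, Real.exp (β e * edgeSpinProd x e)

/-- Subgraphs-world partition function. -/
noncomputable def Zsubs (G : SimpleGraph V) [DecidableRel G.Adj] (lam : Sym2 V → ℝ) : ℝ :=
  ∑ y ∈ G.edgeFinset.powerset.filter (fun y => IsEvenSubgraph y), ∏ e ∈ y, lam e

/-- Random-cluster partition function. -/
noncomputable def Zrc (G : SimpleGraph V) [DecidableRel G.Adj] (p : Sym2 V → ℝ) : ℝ :=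
  ∑ z ∈ G.edgeFinset.powerset,
    (∏ e ∈ z, p e) * (∏ e ∈ G.edgeFinset \ z, (1 - p e)) * 2 ^ numComponents z

omit [Fintype V] [DecidableEq V] in
/-- The spin product over an edge is either `1` or `-1`. -/
lemma edgeSpinProd_eq_one_or_neg_one (x : V → ℤˣ) (e : Sym2 V) :
    edgeSpinProd x e = 1 ∨ edgeSpinProd x e = -1 := by
  induction e using Sym2.ind with
  | _ i j =>
    rcases Int.units_eq_one_or (x i) with hi | hi <;>
      rcases Int.units_eq_one_or (x j) with hj | hj <;> simp [edgeSpinProd, hi, hj]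

omit [Fintype V] [DecidableEq V] in
lemma edgeSpinProd_mk_eq_one_iff (x : V → ℤˣ) (i j : V) :
    edgeSpinProd x s(i, j) = 1 ↔ x i = x j := by
  rcases Int.units_eq_one_or (x i) with hi | hi <;>
    rcases Int.units_eq_one_or (x j) with hj | hj <;> norm_num [edgeSpinProd, hi, hj]

/-- The spin product over a proper edge, as a product over all vertices. -/
lemma edgeSpinProd_eq_prod_ite (x : V → ℤˣ) {e : Sym2 V} (he : ¬ e.IsDiag) :
    edgeSpinProd x e = ∏ i, if i ∈ e then ((x i : ℤ) : ℝ) else 1 := by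
  induction e using Sym2.ind with
  | _ i j =>
    have hij : i ≠ j := he
    have hfilter : univ.filter (fun k => k ∈ s(i, j)) = {i, j} := by ext; simp
    rw [← prod_filter, hfilter, prod_pair hij]
    rfl

/-- The spin configurations agreeing along every edge of `z` are those constant on components. -/
lemma card_filter_edgeSpinProd_eq_one (z : Finset (Sym2 V)) :
    (univ.filter (fun x : V → ℤˣ => ∀ e ∈ z, edgeSpinProd x e = 1)).card =
      2 ^ numComponents z := by
  classical
  set H := SimpleGraph.fromEdgeSet (z : Set (Sym2 V))
  have himage : univ.filter (fun x : V → ℤˣ => ∀ e ∈ z, edgeSpinProd x e = 1) =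
      univ.image (fun f : H.ConnectedComponent → ℤˣ => f ∘ H.connectedComponentMk) := by
    ext x
    simp only [mem_filter, mem_univ, true_and, mem_image]
    constructor
    · intro hx
      have hwalk : ∀ i j (w : H.Walk i j), x i = x j := by
        intro i j w
        induction w with
        | nil => rfl
        | cons h _ ih =>
          refine Eq.trans ?_ ih
          exact (edgeSpinProd_mk_eq_one_iff x _ _).1
            (hx _ (((SimpleGraph.fromEdgeSet_adj _).1 h).1))
      exact ⟨SimpleGraph.ConnectedComponent.lift x fun i j w _ => hwalk i j w, rfl⟩
    · rintro ⟨f, rfl⟩ e he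
      induction e using Sym2.ind with
      | _ i j =>
        rw [edgeSpinProd_mk_eq_one_iff]
        by_cases hij : i = j
        · rw [hij]
        · have hadj : H.Adj i j := (SimpleGraph.fromEdgeSet_adj _).2 ⟨he, hij⟩
          exact congrArg f (SimpleGraph.ConnectedComponent.sound hadj.reachable)
  have hinj : Function.Injective
      (fun f : H.ConnectedComponent → ℤˣ => f ∘ H.connectedComponentMk) :=
    Function.Surjective.injective_comp_right Quot.mk_surjective
  rw [himage, card_image_of_injective _ hinj, card_univ, Fintype.card_fun,
    Fintype.card_units_int, numComponents, Nat.card_eq_fintype_card]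

lemma sum_prod_one_add_edgeSpinProd_div_two (z : Finset (Sym2 V)) :
    ∑ x : V → ℤˣ, ∏ e ∈ z, (1 + edgeSpinProd x e) / 2 = (2 : ℝ) ^ numComponents z := by
  classical
  have hindicator (x : V → ℤˣ) : ∏ e ∈ z, (1 + edgeSpinProd x e) / 2 =
      if ∀ e ∈ z, edgeSpinProd x e = 1 then (1 : ℝ) else 0 := by
    split_ifs with h
    · exact prod_eq_one fun e he => by rw [h e he]; norm_num
    · push Not at h
      obtain ⟨e, he, hne⟩ := h
      refine prod_eq_zero he ?_
      rw [(edgeSpinProd_eq_one_or_neg_one x e).resolve_left hne]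
      norm_num
  simp_rw [hindicator]
  rw [sum_boole, card_filter_edgeSpinProd_eq_one]
  push_cast
  rfl

lemma sum_units_int_pow (n : ℕ) :
    ∑ u : ℤˣ, ((u : ℤ) : ℝ) ^ n = if Even n then 2 else 0 := by
  rw [show (univ : Finset ℤˣ) = {1, -1} from rfl, sum_pair (by decide)]
  split_ifs with hn
  · simp [hn.neg_one_pow]; norm_num
  · simp [(Nat.not_even_iff_odd.1 hn).neg_one_pow]

/-- Summing spin products over all configurations detects even edge subsets. -/
lemma sum_prod_edgeSpinProd {y : Finset (Sym2 V)} (hy : ∀ e ∈ y, ¬ e.IsDiag) :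
    ∑ x : V → ℤˣ, ∏ e ∈ y, edgeSpinProd x e =
      if IsEvenSubgraph y then (2 : ℝ) ^ Fintype.card V else 0 := by
  have hdegree (x : V → ℤˣ) : ∏ e ∈ y, edgeSpinProd x e =
      ∏ i, ((x i : ℤ) : ℝ) ^ (y.filter (fun e => i ∈ e)).card := by
    rw [prod_congr rfl fun e he => edgeSpinProd_eq_prod_ite x (hy e he), prod_comm]
    simp [← prod_filter]
  simp_rw [hdegree]
  rw [← Fintype.prod_sum fun i (u : ℤˣ) => ((u : ℤ) : ℝ) ^ (y.filter (fun e => i ∈ e)).card]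
  simp_rw [sum_units_int_pow]
  rw [prod_ite_zero, prod_const, card_univ]
  simp only [mem_univ, true_imp_iff, IsEvenSubgraph]
  congr

/-- The random cluster partition function as a sum over spin configurations. -/
lemma Zrc_eq_sum_spins (G : SimpleGraph V) [DecidableRel G.Adj] (p : Sym2 V → ℝ) :
    Zrc G p = ∑ x : V → ℤˣ, ∏ e ∈ G.edgeFinset,
      (p e * ((1 + edgeSpinProd x e) / 2) + (1 - p e)) := by
  simp_rw [prod_add]
  rw [sum_comm]
  refine sum_congr rfl fun z _ => ?_
  rw [← sum_prod_one_add_edgeSpinProd_div_two, mul_sum]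
  refine sum_congr rfl fun x _ => ?_
  rw [prod_mul_distrib]
  ring

/-- The high-temperature expansion. -/
lemma sum_prod_mul_edgeSpinProd_add_one (G : SimpleGraph V) [DecidableRel G.Adj]
    (lam : Sym2 V → ℝ) :
    ∑ x : V → ℤˣ, ∏ e ∈ G.edgeFinset, (lam e * edgeSpinProd x e + 1) =
      Zsubs G lam * 2 ^ Fintype.card V := by
  simp_rw [prod_add_one, prod_mul_distrib]
  rw [sum_comm, Zsubs, sum_mul, sum_filter]
  refine sum_congr rfl fun y hy => ?_
  rw [← mul_sum, sum_prod_edgeSpinProd fun e he =>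
    G.not_isDiag_of_mem_edgeFinset (mem_powerset.1 hy he)]
  split_ifs <;> simp

lemma tanh_mul_one_add_exp_neg_two_mul (b : ℝ) :
    Real.tanh b * (1 + Real.exp (-2 * b)) = 1 - Real.exp (-2 * b) := by
  have hexp : Real.exp (-2 * b) = Real.exp (-b) * Real.exp (-b) := by
    rw [← Real.exp_add]; ring_nf
  have hinv : Real.exp b * Real.exp (-b) = 1 := by rw [← Real.exp_add]; simp
  have hpos : Real.exp b + Real.exp (-b) ≠ 0 := by positivity
  rw [Real.tanh_eq, hexp]
  field_simp
  linear_combination (2 * Real.exp (-b)) * hinv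

/-- `Z_rc(p) = Z_subs(λ) ⬝ 2^{|V| - |E|} ⬝ ∏ (1 + exp(-2β(e)))`
where `λ(e) = tanh β(e)` and `p(e) = 1 - exp(-2 β(e))`. -/
theorem rc_eq_subs (G : SimpleGraph V) [DecidableRel G.Adj]
    (β : Sym2 V → ℝ) (hβ : ∀ e ∈ G.edgeFinset, 0 ≤ β e) :
    Zrc G (fun e => 1 - Real.exp (-2 * β e)) =
      Zsubs G (fun e => Real.tanh (β e)) *
        (2 : ℝ) ^ ((Fintype.card V : ℤ) - (G.edgeFinset.card : ℤ)) *
        ∏ e ∈ G.edgeFinset, (1 + Real.exp (-2 * β e)) := by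
  have hedge (x : V → ℤˣ) (e : Sym2 V) :
      (1 - Real.exp (-2 * β e)) * ((1 + edgeSpinProd x e) / 2) +
          (1 - (1 - Real.exp (-2 * β e))) =
        (Real.tanh (β e) * edgeSpinProd x e + 1) * ((1 + Real.exp (-2 * β e)) / 2) := by
    linear_combination (-edgeSpinProd x e / 2) * tanh_mul_one_add_exp_neg_two_mul (β e)
  rw [Zrc_eq_sum_spins]
  simp_rw [hedge, prod_mul_distrib]
  rw [← sum_mul, sum_prod_mul_edgeSpinProd_add_one, prod_div_distrib, prod_const,
    zpow_sub₀ two_ne_zero, zpow_natCast, zpow_natCast]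
  ring
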